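/- Let Y be a real m×n matrix, Ω a set of index pairs, C > 0, λ > 0, and Θ an m×m real positive definite matrix. Then strong duality holds: the infimum over all entrywise-nonnegative real m×n matrices W of C‖W_Ω − Y_Ω‖² + (1/(2λ)) tr(Wᵀ Θ⁻¹ W) equals the supremum over all pairs (Z, S) of real m×n matrices with Z supported on Ω and S entrywise nonnegative of ⟨Z, Y_Ω⟩ − ‖Z‖²/(4C) − (λ/2) tr((Z+S)ᵀ Θ (Z+S)). -/

import Mathlib

open Matrix

open scoped Classical in
/-- The restriction `A_Ω` of a matrix to an index set `Ω`: entries outside `Ω` are set to `0`. -/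
noncomputable def restrictM {m n : ℕ} (Ω : Set (Fin m × Fin n))
    (A : Matrix (Fin m) (Fin n) ℝ) : Matrix (Fin m) (Fin n) ℝ :=
  Matrix.of fun i j => if (i, j) ∈ Ω then A i j else 0

section restrictM

variable {m n : ℕ} (Ω : Set (Fin m × Fin n)) (A B : Matrix (Fin m) (Fin n) ℝ)

theorem restrictM_add_smul (t : ℝ) :
    restrictM Ω (A + t • B) = restrictM Ω A + t • restrictM Ω B := by
  ext i j
  by_cases h : (i, j) ∈ Ω <;> simp [restrictM, h]

theorem restrictM_smul_sub_restrictM (c : ℝ) :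
    restrictM Ω (c • (restrictM Ω A - restrictM Ω B)) =
      c • (restrictM Ω A - restrictM Ω B) := by
  ext i j
  by_cases h : (i, j) ∈ Ω <;> simp [restrictM, h]

theorem trace_restrictM_transpose_mul :
    ((restrictM Ω A)ᵀ * B).trace = ((restrictM Ω A)ᵀ * restrictM Ω B).trace := by
  simp only [Matrix.trace, Matrix.diag, Matrix.mul_apply, Matrix.transpose_apply]
  refine Finset.sum_congr rfl fun j _ => Finset.sum_congr rfl fun i _ => ?_
  by_cases h : (i, j) ∈ Ω <;> simp [restrictM, h]

theorem trace_restrictM_sub_restrictM_transpose_mul (D : Matrix (Fin m) (Fin n) ℝ) :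
    ((restrictM Ω A - restrictM Ω B)ᵀ * D).trace =
      ((restrictM Ω A - restrictM Ω B)ᵀ * restrictM Ω D).trace := by
  simp only [Matrix.transpose_sub, Matrix.sub_mul, Matrix.trace_sub,
    trace_restrictM_transpose_mul Ω _ D]

theorem continuous_restrictM :
    Continuous (restrictM Ω : Matrix (Fin m) (Fin n) ℝ → Matrix (Fin m) (Fin n) ℝ) := by
  refine continuous_matrix fun i j => ?_
  by_cases h : (i, j) ∈ Ω
  · simpa [restrictM, h] using continuous_id.matrix_elem i j
  · simpa [restrictM, h] using continuous_const

end restrictM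

section traceForm

theorem Matrix.PosDef.transpose_eq {ι : Type*} {M : Matrix ι ι ℝ} (hM : M.PosDef) : Mᵀ = M := by
  simpa using hM.isHermitian.eq

variable {ι κ : Type*} [Fintype ι] [Fintype κ]

theorem trace_transpose_mul_nonneg {A B : Matrix ι κ ℝ} (hA : ∀ i j, 0 ≤ A i j)
    (hB : ∀ i j, 0 ≤ B i j) : 0 ≤ (Aᵀ * B).trace :=
  Finset.sum_nonneg fun j _ => Finset.sum_nonneg fun i _ => mul_nonneg (hA i j) (hB i j)

theorem trace_transpose_mul_comm (A B : Matrix ι κ ℝ) :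
    (Aᵀ * B).trace = (Bᵀ * A).trace := by
  rw [← Matrix.trace_transpose, Matrix.transpose_mul, Matrix.transpose_transpose]

theorem trace_transpose_mul_mul_comm {M : Matrix ι ι ℝ} (hM : Mᵀ = M) (A B : Matrix ι κ ℝ) :
    (Aᵀ * M * B).trace = (Bᵀ * M * A).trace := by
  rw [← Matrix.trace_transpose]
  simp [Matrix.transpose_mul, hM, Matrix.mul_assoc]

theorem Matrix.PosSemidef.trace_transpose_mul_mul_nonneg {M : Matrix ι ι ℝ}
    (hM : M.PosSemidef) (A : Matrix ι κ ℝ) : 0 ≤ (Aᵀ * M * A).trace := by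
  simpa using (hM.conjTranspose_mul_mul_same A).trace_nonneg

variable [DecidableEq ι]

/-- The Fenchel–Young inequality for the quadratic form of a positive definite matrix. -/
theorem Matrix.PosDef.two_mul_trace_le {M : Matrix ι ι ℝ} (hM : M.PosDef)
    (X W : Matrix ι κ ℝ) (t : ℝ) :
    2 * t * (Xᵀ * W).trace ≤ (Wᵀ * M⁻¹ * W).trace + t ^ 2 * (Xᵀ * M * X).trace := by
  have hdet : IsUnit M.det := hM.det_pos.ne'.isUnit
  have h := hM.inv.posSemidef.trace_transpose_mul_mul_nonneg (W - t • (M * X))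
  have h₁ : (Wᵀ * M⁻¹ * (M * X)).trace = (Xᵀ * W).trace := by
    rw [Matrix.mul_assoc, Matrix.nonsing_inv_mul_cancel_left _ _ hdet, trace_transpose_mul_comm]
  have h₂ : ((M * X)ᵀ * M⁻¹ * W).trace = (Xᵀ * W).trace := by
    rw [trace_transpose_mul_mul_comm hM.inv.transpose_eq, h₁]
  have h₃ : ((M * X)ᵀ * M⁻¹ * (M * X)).trace = (Xᵀ * M * X).trace := by
    rw [Matrix.mul_assoc, Matrix.nonsing_inv_mul_cancel_left _ _ hdet, Matrix.transpose_mul,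
      hM.transpose_eq]
  simp only [Matrix.transpose_sub, Matrix.transpose_smul, Matrix.sub_mul, Matrix.mul_sub,
    Matrix.smul_mul, Matrix.mul_smul, Matrix.trace_sub, Matrix.trace_smul, smul_eq_mul,
    h₁, h₂, h₃] at h
  linarith

end traceForm

theorem nonneg_of_forall_mul_add_sq_mul_nonneg {a b : ℝ}
    (h : ∀ t : ℝ, 0 < t → t ≤ 1 → 0 ≤ t * a + t ^ 2 * b) : 0 ≤ a := by
  by_contra! ha
  have hd : 0 < |b| - a := by linarith [abs_nonneg b]
  have ht : 0 < -a / (2 * (|b| - a)) := div_pos (by linarith) (by linarith)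
  have ht₁ : -a / (2 * (|b| - a)) ≤ 1 := by
    rw [div_le_one (by linarith)]; linarith [abs_nonneg b]
  have h₀ := h _ ht ht₁
  have h₁ : 0 ≤ a + -a / (2 * (|b| - a)) * b := by
    refine nonneg_of_mul_nonneg_right (?_ : 0 ≤ -a / (2 * (|b| - a)) * _) ht
    linarith
  have h₂ : -a / (2 * (|b| - a)) * b ≤ -a / 2 := by
    rw [div_mul_eq_mul_div, div_le_div_iff₀ (by linarith) two_pos]
    nlinarith [le_abs_self b]
  linarith

section duality

variable {m n : ℕ} (Y : Matrix (Fin m) (Fin n) ℝ) (Ω : Set (Fin m × Fin n)) (C l : ℝ)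
  (Θ : Matrix (Fin m) (Fin m) ℝ)

/-- The objective of the regularized completion problem. -/
noncomputable def primalObjective (W : Matrix (Fin m) (Fin n) ℝ) : ℝ :=
  C * ((restrictM Ω W - restrictM Ω Y)ᵀ * (restrictM Ω W - restrictM Ω Y)).trace
    + (1 / (2 * l)) * (Wᵀ * Θ⁻¹ * W).trace

/-- The objective of the partial dual problem. -/
noncomputable def dualObjective (Z S : Matrix (Fin m) (Fin n) ℝ) : ℝ :=
  (Zᵀ * restrictM Ω Y).trace - (Zᵀ * Z).trace / (4 * C)
    - (l / 2) * ((Z + S)ᵀ * Θ * (Z + S)).trace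

/-- The gradient of `primalObjective`. -/
noncomputable def primalGradient (W : Matrix (Fin m) (Fin n) ℝ) : Matrix (Fin m) (Fin n) ℝ :=
  (2 * C) • (restrictM Ω W - restrictM Ω Y) + (1 / l) • (Θ⁻¹ * W)

variable {C l Θ}

theorem dualObjective_le_primalObjective (hC : 0 < C) (hl : 0 < l) (hΘ : Θ.PosDef)
    {W Z S : Matrix (Fin m) (Fin n) ℝ} (hW : ∀ i j, 0 ≤ W i j) (hZ : restrictM Ω Z = Z)
    (hS : ∀ i j, 0 ≤ S i j) :
    dualObjective Y Ω C l Θ Z S ≤ primalObjective Y Ω C l Θ W := by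
  unfold dualObjective primalObjective
  have hy := hΘ.two_mul_trace_le (Z + S) W l
  have hSW := trace_transpose_mul_nonneg hS hW
  have hZW : (Zᵀ * W).trace = (Zᵀ * restrictM Ω W).trace := by
    rw [← hZ, trace_restrictM_transpose_mul]
  set E := restrictM Ω W - restrictM Ω Y with hE
  have hWE : restrictM Ω W = restrictM Ω Y + E := by rw [hE]; abel
  have hsq := Matrix.PosSemidef.one.trace_transpose_mul_mul_nonneg ((2 * C) • E + Z)
  have hEZ := trace_transpose_mul_comm E Z
  simp only [hWE, Matrix.transpose_add, Matrix.add_mul, Matrix.mul_add, Matrix.mul_one,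
    Matrix.transpose_smul, Matrix.smul_mul, Matrix.mul_smul, Matrix.trace_add,
    Matrix.trace_smul, smul_eq_mul, hEZ] at hy hZW hsq ⊢
  have h₁ : 0 ≤ C * (Eᵀ * E).trace + (Zᵀ * E).trace + (Zᵀ * Z).trace / (4 * C) := by
    refine (div_nonneg hsq (by positivity : 0 ≤ 4 * C)).trans_eq ?_
    field_simp
    ring
  have h₂ := div_le_div_of_nonneg_right hy (by positivity : 0 ≤ 2 * l)
  have hl₂ : l ^ 2 / (2 * l) = l / 2 := by field_simp
  rw [mul_div_cancel_left₀ _ (by positivity), add_div, mul_div_right_comm, hl₂] at h₂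
  rw [one_div_mul_eq_div]
  linarith

theorem primalObjective_add_smul (hΘ : Θ.PosDef) (W D : Matrix (Fin m) (Fin n) ℝ) (t : ℝ) :
    primalObjective Y Ω C l Θ (W + t • D) = primalObjective Y Ω C l Θ W +
      (t * ((primalGradient Y Ω C l Θ W)ᵀ * D).trace +
        t ^ 2 * (C * ((restrictM Ω D)ᵀ * restrictM Ω D).trace +
          (1 / (2 * l)) * (Dᵀ * Θ⁻¹ * D).trace)) := by
  have hE : restrictM Ω (W + t • D) - restrictM Ω Y =
      (restrictM Ω W - restrictM Ω Y) + t • restrictM Ω D := by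
    rw [restrictM_add_smul]; abel
  have hG := trace_restrictM_sub_restrictM_transpose_mul Ω W Y D
  have hsymm := trace_transpose_mul_mul_comm hΘ.inv.transpose_eq D W
  unfold primalObjective primalGradient
  rw [hE]
  set E := restrictM Ω W - restrictM Ω Y
  have hEZ := trace_transpose_mul_comm (restrictM Ω D) E
  simp only [Matrix.transpose_add, Matrix.add_mul, Matrix.mul_add, Matrix.transpose_mul,
    Matrix.transpose_smul, Matrix.smul_mul, Matrix.mul_smul, Matrix.trace_add,
    Matrix.trace_smul, smul_eq_mul, hEZ, hG, hsymm, hΘ.inv.transpose_eq]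
  ring

theorem continuous_primalObjective : Continuous (primalObjective Y Ω C l Θ) := by
  have := continuous_restrictM Ω
  unfold primalObjective
  fun_prop

theorem exists_forall_primalObjective_le (hC : 0 < C) (hl : 0 < l) (hΘ : Θ.PosDef) :
    ∃ W : Matrix (Fin m) (Fin n) ℝ, (∀ i j, 0 ≤ W i j) ∧
      ∀ V : Matrix (Fin m) (Fin n) ℝ, (∀ i j, 0 ≤ V i j) →
        primalObjective Y Ω C l Θ W ≤ primalObjective Y Ω C l Θ V := by
  set f := primalObjective Y Ω C l Θ with hf
  let s : Set (Matrix (Fin m) (Fin n) ℝ) := {W | (∀ i j, 0 ≤ W i j) ∧ f W ≤ f 0}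
  have hcont : Continuous f := continuous_primalObjective Y Ω
  have hclosed : IsClosed s := by
    refine IsClosed.inter ?_ (isClosed_le hcont continuous_const)
    change IsClosed {W : Matrix (Fin m) (Fin n) ℝ | ∀ i j, 0 ≤ W i j}
    simp only [Set.ofPred_forall]
    exact isClosed_iInter fun i => isClosed_iInter fun j =>
      isClosed_le continuous_const (continuous_id.matrix_elem i j)
  let K : Matrix (Fin m) (Fin n) ℝ := Matrix.of fun i _ => (2 * l * f 0 + Θ i i) / 2
  have hbox : IsCompact {W : Matrix (Fin m) (Fin n) ℝ | ∀ i j, W i j ∈ Set.Icc 0 (K i j)} := by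
    have h : IsCompact (Set.univ.pi fun i => Set.univ.pi fun j => Set.Icc 0 (K i j)) :=
      isCompact_univ_pi fun i => isCompact_univ_pi fun j => isCompact_Icc
    simpa only [Set.pi, Set.mem_univ, true_imp_iff] using! h
  have hsub : s ⊆ {W | ∀ i j, W i j ∈ Set.Icc 0 (K i j)} := by
    rintro W ⟨hW, hle⟩ i j
    refine ⟨hW i j, ?_⟩
    have hy := hΘ.two_mul_trace_le (Matrix.single i j 1) W 1
    have hq : (Wᵀ * Θ⁻¹ * W).trace ≤ 2 * l * f 0 := by
      have hsq := Matrix.PosSemidef.one.trace_transpose_mul_mul_nonneg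
        (restrictM Ω W - restrictM Ω Y)
      rw [Matrix.mul_one] at hsq
      have h : (1 / (2 * l)) * (Wᵀ * Θ⁻¹ * W).trace ≤ f 0 := by
        refine le_trans ?_ hle
        rw [hf, primalObjective]
        exact le_add_of_nonneg_left (mul_nonneg hC.le hsq)
      field_simp at h
      linarith
    simp [Matrix.transpose_single, Matrix.trace_single_mul, Matrix.single_mul_mul_single] at hy
    simp only [K, Matrix.of_apply]
    linarith
  obtain ⟨W, hW, hmin⟩ := (hbox.of_isClosed_subset hclosed hsub).exists_isMinOn
    ⟨0, fun _ _ => le_rfl, le_rfl⟩ hcont.continuousOn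
  refine ⟨W, hW.1, fun V hV => ?_⟩
  rcases le_total (f V) (f 0) with h | h
  · exact hmin ⟨hV, h⟩
  · exact hW.2.trans h

theorem exists_primalObjective_eq_dualObjective (hC : 0 < C) (hl : 0 < l) (hΘ : Θ.PosDef) :
    ∃ W Z S : Matrix (Fin m) (Fin n) ℝ, (∀ i j, 0 ≤ W i j) ∧ restrictM Ω Z = Z ∧
      (∀ i j, 0 ≤ S i j) ∧ primalObjective Y Ω C l Θ W = dualObjective Y Ω C l Θ Z S := by
  obtain ⟨W, hW, hmin⟩ := exists_forall_primalObjective_le Y Ω hC hl hΘ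
  set G := primalGradient Y Ω C l Θ W with hG
  have hdir (D : Matrix (Fin m) (Fin n) ℝ)
      (hD : ∀ t : ℝ, 0 < t → t ≤ 1 → ∀ i j, 0 ≤ (W + t • D) i j) : 0 ≤ (Gᵀ * D).trace := by
    refine nonneg_of_forall_mul_add_sq_mul_nonneg
      (b := C * ((restrictM Ω D)ᵀ * restrictM Ω D).trace +
        (1 / (2 * l)) * (Dᵀ * Θ⁻¹ * D).trace) fun t ht ht₁ => ?_
    have h := hmin _ (hD t ht ht₁)
    rw [primalObjective_add_smul Y Ω hΘ] at h
    linarith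
  have hGnonneg (i j) : 0 ≤ G i j := by
    have h := hdir (Matrix.single i j 1) fun t ht _ i' j' => by
      have : 0 ≤ Matrix.single i j (1 : ℝ) i' j' := by
        rw [Matrix.single_apply]; split_ifs <;> norm_num
      exact add_nonneg (hW i' j') (mul_nonneg ht.le this)
    rw [trace_transpose_mul_comm] at h
    simpa [Matrix.transpose_single, Matrix.trace_single_mul] using h
  have hGW : (Gᵀ * W).trace = 0 := by
    refine le_antisymm ?_ (trace_transpose_mul_nonneg hGnonneg hW)
    have h := hdir (-W) fun t _ ht₁ i j => by
      have := mul_nonneg (sub_nonneg.2 ht₁) (hW i j)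
      simp only [Matrix.add_apply, Matrix.smul_apply, Matrix.neg_apply, smul_eq_mul]
      linarith
    simpa using h
  refine ⟨W, (-(2 * C)) • (restrictM Ω W - restrictM Ω Y), G, hW,
    restrictM_smul_sub_restrictM .., hGnonneg, ?_⟩
  have hsum : (-(2 * C)) • (restrictM Ω W - restrictM Ω Y) + G = (1 / l) • (Θ⁻¹ * W) := by
    rw [hG, primalGradient, neg_smul]; abel
  have hEW := trace_restrictM_sub_restrictM_transpose_mul Ω W Y W
  have hdet : IsUnit Θ.det := hΘ.det_pos.ne'.isUnit
  have hquad : ((Θ⁻¹ * W)ᵀ * Θ * (Θ⁻¹ * W)).trace = (Wᵀ * Θ⁻¹ * W).trace := by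
    rw [Matrix.mul_assoc, Matrix.mul_nonsing_inv_cancel_left _ _ hdet, Matrix.transpose_mul,
      hΘ.inv.transpose_eq]
  rw [hG, primalGradient] at hGW
  rw [primalObjective, dualObjective, hsum]
  set E := restrictM Ω W - restrictM Ω Y with hE
  have hYE : restrictM Ω W = restrictM Ω Y + E := by rw [hE]; abel
  simp only [hYE, Matrix.transpose_add, Matrix.add_mul, Matrix.mul_add,
    Matrix.transpose_smul, Matrix.smul_mul, Matrix.mul_smul, Matrix.trace_add,
    Matrix.trace_smul, smul_eq_mul, hquad] at hEW hGW ⊢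
  rw [Matrix.transpose_mul, hΘ.inv.transpose_eq, hEW] at hGW
  field_simp at hGW ⊢
  linarith

end duality

/-- strong duality: the infimum of the primal objective over
entrywise-nonnegative `W` equals the supremum of the dual objective over pairs `(Z, S)`
with `Z` supported on `Ω` and `S` entrywise nonnegative. -/
theorem strong_duality {m n : ℕ} (Y : Matrix (Fin m) (Fin n) ℝ)
    (Ω : Set (Fin m × Fin n)) (C : ℝ) (hC : 0 < C) (l : ℝ) (hl : 0 < l)
    (Θ : Matrix (Fin m) (Fin m) ℝ) (hΘ : Θ.PosDef) :
    sInf { v : ℝ | ∃ W : Matrix (Fin m) (Fin n) ℝ, (∀ i j, 0 ≤ W i j) ∧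
        v = C * ((restrictM Ω W - restrictM Ω Y)ᵀ * (restrictM Ω W - restrictM Ω Y)).trace
          + (1 / (2 * l)) * (Wᵀ * Θ⁻¹ * W).trace } =
      sSup { v : ℝ | ∃ Z S : Matrix (Fin m) (Fin n) ℝ,
        restrictM Ω Z = Z ∧ (∀ i j, 0 ≤ S i j) ∧
        v = (Zᵀ * restrictM Ω Y).trace - (Zᵀ * Z).trace / (4 * C)
          - (l / 2) * ((Z + S)ᵀ * Θ * (Z + S)).trace } := by
  obtain ⟨W, Z, S, hW, hZ, hS, heq⟩ := exists_primalObjective_eq_dualObjective Y Ω hC hl hΘ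
  trans primalObjective Y Ω C l Θ W
  · refine IsLeast.csInf_eq ⟨⟨W, hW, rfl⟩, ?_⟩
    rintro _ ⟨V, hV, rfl⟩
    exact heq.trans_le (dualObjective_le_primalObjective Y Ω hC hl hΘ hV hZ hS)
  · symm
    refine IsGreatest.csSup_eq ⟨⟨Z, S, hZ, hS, heq⟩, ?_⟩
    rintro _ ⟨Z', S', hZ', hS', rfl⟩
    exact dualObjective_le_primalObjective Y Ω hC hl hΘ hW hZ' hS'
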